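/- Let e = 2m with m ≥ 1, suppose s divides m and m/s ≡ 0 (mod 2), and let a ∈ F_q with a ≠ 0. If the equation X^{p^{2l}} + X = -a^{p^l} has no solution in F_q, then ψ_3(a) = 0. If it has a solution γ in F_q, then ψ_3(a) = -((p-1)/2) p^{e+m+s-3} - ((p-1)/2) p^{e+m+s-2} η(-Tr(γ^{p^l+1})) if Tr(γ^{p^l+1}) ≠ 0, while ψ_3(a) = ((p-1)^2/2) p^{e+m+s-3} if Tr(γ^{p^l+1}) = 0. -/

import Mathlib

open scoped BigOperators

noncomputable section

/-- The primitive `p`-th root of unity `ζ_p = exp(2πi/p)`. -/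
def zetaP (p : ℕ) : ℂ := Complex.exp (2 * Real.pi * Complex.I / p)

/-- The absolute trace map from `F_q = GF(p^e)` onto `F_p`. -/
def tr (p e : ℕ) [Fact p.Prime] (x : GaloisField p e) : ZMod p :=
  Algebra.trace (ZMod p) (GaloisField p e) x

/-- The Weil sum `S(α, β) = Σ_{x ∈ F_q} ζ_p^{Tr(α x^{p^l+1} + β x)}`. -/
def weilSum (p e l : ℕ) [Fact p.Prime] (α β : GaloisField p e) : ℂ :=
  letI : Fintype (GaloisField p e) := Fintype.ofFinite _
  ∑ x : GaloisField p e, zetaP p ^ (tr p e (α * x ^ (p ^ l + 1) + β * x)).val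

/- The quadratic character `η` of `F_p`, integer-valued:
`η(0) = 0`, `η(x) = 1` for nonzero squares, `η(x) = -1` for nonsquares. -/
open Classical in
def eta (p : ℕ) (x : ZMod p) : ℤ :=
  if x = 0 then 0 else if IsSquare x then 1 else -1

/- The cyclotomic classes of order 2 in `F_p^*`: `cyc p 0` is the set of nonzero
squares `C_0^{(2,p)}`, and `cyc p 1` is the set of nonsquares `C_1^{(2,p)}`. -/
open Classical in
def cyc (p : ℕ) [Fact p.Prime] (i : ℕ) : Finset (ZMod p) :=
  Finset.univ.filter (fun x => x ≠ 0 ∧ (if i = 0 then IsSquare x else ¬ IsSquare x))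

/-- `ψ_3(a) = ((p-1)/2) p^{e-3} Σ_{z1 ∈ F_p^*} ζ_p^{-z1} Σ_{z3 ∈ F_p^*} S(z1, a z3)`. -/
def psi3 (p e l : ℕ) [Fact p.Prime] (a : GaloisField p e) : ℂ :=
  ((p : ℂ) - 1) / 2 * (p : ℂ) ^ ((e : ℤ) - 3) *
    ∑ z1 ∈ ({0}ᶜ : Finset (ZMod p)), zetaP p ^ (-z1).val *
      ∑ z3 ∈ ({0}ᶜ : Finset (ZMod p)),
        weilSum p e l (algebraMap (ZMod p) (GaloisField p e) z1)
          (a * algebraMap (ZMod p) (GaloisField p e) z3)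

/-- `ψ_4^{(i)}(a, b) = p^{e-3} Σ_{c ∈ C_i} Σ_{z1 ∈ F_p^*} ζ_p^{-z1}
      Σ_{z2 ∈ F_p^*} ζ_p^{-c z2} S(z1, -a b⁻¹ z2)`, for `b ∈ F_p^*`. -/
def psi4 (p e l : ℕ) [Fact p.Prime] (i : ℕ) (a : GaloisField p e) (b : ZMod p) : ℂ :=
  (p : ℂ) ^ ((e : ℤ) - 3) *
    ∑ c ∈ cyc p i, ∑ z1 ∈ ({0}ᶜ : Finset (ZMod p)), zetaP p ^ (-z1).val *
      ∑ z2 ∈ ({0}ᶜ : Finset (ZMod p)), zetaP p ^ (-(c * z2)).val *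
        weilSum p e l (algebraMap (ZMod p) (GaloisField p e) z1)
          (-a * algebraMap (ZMod p) (GaloisField p e) (b⁻¹ * z2))

/-- `T_i(a,b) = |{(x1,x2) ∈ F_q² : Tr(x1^{p^l+1}) = 1, Tr(x2) ∈ C_i, Tr(a x1 + b x2) = 0}|`. -/
def Tcount (p e l : ℕ) [Fact p.Prime] (i : ℕ) (a b : GaloisField p e) : ℕ :=
  Nat.card {x : GaloisField p e × GaloisField p e //
    tr p e (x.1 ^ (p ^ l + 1)) = 1 ∧ tr p e x.2 ∈ cyc p i ∧ tr p e (a * x.1 + b * x.2) = 0}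

/-- The defining set `D_i = {(x1,x2) ∈ F_q² : Tr(x1^{p^l+1}) = 1, Tr(x2) ∈ C_i^{(2,p)}}`. -/
def Dset (p e l : ℕ) [Fact p.Prime] (i : ℕ) : Set (GaloisField p e × GaloisField p e) :=
  {x | tr p e (x.1 ^ (p ^ l + 1)) = 1 ∧ tr p e x.2 ∈ cyc p i}

/-- The codeword of `C_{D_i}` indexed by `(a, b) ∈ F_q²`:
the vector `(Tr(a x1 + b x2))_{(x1,x2) ∈ D_i}`. -/
def codeword (p e l : ℕ) [Fact p.Prime] (i : ℕ) (a b : GaloisField p e) :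
    Dset p e l i → ZMod p :=
  fun x => tr p e (a * x.1.1 + b * x.1.2)

/-- The linear code `C_{D_i} = {(Tr(a x1 + b x2))_{(x1,x2) ∈ D_i} : a, b ∈ F_q}`. -/
def code (p e l : ℕ) [Fact p.Prime] (i : ℕ) : Set (Dset p e l i → ZMod p) :=
  Set.range (fun ab : GaloisField p e × GaloisField p e => codeword p e l i ab.1 ab.2)

/-- The Hamming weight of a vector: the number of nonzero coordinates. -/
def wt {ι : Type*} {p : ℕ} (c : ι → ZMod p) : ℕ := Nat.card {x : ι // c x ≠ 0}

section helpers

set_option linter.unusedSectionVars false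
set_option linter.style.haveILetI false

variable {p : ℕ} [Fact p.Prime] {F : Type} [Field F] [Fintype F] [Algebra (ZMod p) F]

theorem aux_charP : CharP F p :=
  charP_of_injective_algebraMap (algebraMap (ZMod p) F).injective p

theorem aux_trace_pow (l : ℕ) (x : F) :
    Algebra.trace (ZMod p) F (x ^ p ^ l) = Algebra.trace (ZMod p) F x := by
  induction l with
  | zero => simp
  | succ n ih =>
    rw [pow_succ, pow_mul, ← ih]
    haveI : CharP F p := aux_charP
    haveI : ExpChar F p := ExpChar.prime Fact.out
    have h := Algebra.trace_eq_of_algEquiv (FiniteField.frobeniusAlgEquiv (ZMod p) F p) (x ^ p ^ n)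
    rw [FiniteField.frobeniusAlgEquiv_apply] at h
    simpa [ZMod.card] using h

theorem aux_add_pow (l : ℕ) (x y : F) : (x + y) ^ p ^ l = x ^ p ^ l + y ^ p ^ l := by
  haveI : CharP F p := aux_charP
  exact add_pow_char_pow x y p l

theorem aux_alg_pow (l : ℕ) (z : ZMod p) :
    (algebraMap (ZMod p) F z) ^ p ^ l = algebraMap (ZMod p) F z := by
  rw [← map_pow, ZMod.pow_card_pow]

theorem aux_pow_inj (l : ℕ) : Function.Bijective (fun x : F => x ^ p ^ l) := by
  haveI : CharP F p := aux_charP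
  haveI : ExpChar F p := ExpChar.prime Fact.out
  exact Finite.injective_iff_bijective.mp (iterateFrobenius_inj F p l)

/-- additive character of F -/
def auxChi (p : ℕ) [Fact p.Prime] (F : Type) [Field F] [Algebra (ZMod p) F] : AddChar F ℂ :=
  (ZMod.stdAddChar (N := p)).compAddMonoidHom (Algebra.trace (ZMod p) F).toAddMonoidHom

theorem auxChi_apply (x : F) :
    auxChi p F x = ZMod.stdAddChar (Algebra.trace (ZMod p) F x) := rfl

theorem aux_trace_ne : ∃ x : F, Algebra.trace (ZMod p) F x ≠ 0 := by
  obtain ⟨x, hx⟩ := DFunLike.ne_iff.mp (Algebra.trace_ne_zero (ZMod p) F)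
  exact ⟨x, hx⟩

theorem auxChi_prim : (auxChi p F).IsPrimitive := by
  apply AddChar.IsPrimitive.of_ne_one
  intro h
  obtain ⟨x, hx⟩ := aux_trace_ne (p := p) (F := F)
  apply hx
  have := DFunLike.congr_fun h x
  rw [auxChi_apply, AddChar.one_apply] at this
  apply ZMod.injective_stdAddChar
  rw [this, AddChar.map_zero_eq_one]

/-- the Weil sum -/
def auxW (p : ℕ) [Fact p.Prime] (F : Type) [Field F] [Fintype F] [Algebra (ZMod p) F] (l : ℕ)
    (α β : F) : ℂ := ∑ x : F, auxChi p F (α * x ^ (p ^ l + 1) + β * x)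

/-- shift identity -/
theorem aux_shift (l : ℕ) (z : ZMod p) (β x y : F) :
    Algebra.trace (ZMod p) F (algebraMap (ZMod p) F z * (x + y) ^ (p ^ l + 1) + β * (x + y)) =
    Algebra.trace (ZMod p) F (algebraMap (ZMod p) F z * x ^ (p ^ l + 1) + β * x) +
    Algebra.trace (ZMod p) F (algebraMap (ZMod p) F z * y ^ (p ^ l + 1) + β * y) +
    Algebra.trace (ZMod p) F (algebraMap (ZMod p) F z * (y ^ p ^ (2 * l) + y) * x ^ p ^ l) := by
  have h : Algebra.trace (ZMod p) F (algebraMap (ZMod p) F z * (y ^ p ^ (2 * l)) * x ^ p ^ l) =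
      Algebra.trace (ZMod p) F (algebraMap (ZMod p) F z * y ^ p ^ l * x) := by
    rw [← aux_trace_pow l (algebraMap (ZMod p) F z * y ^ p ^ l * x), mul_pow, mul_pow, aux_alg_pow,
      ← pow_mul, ← pow_add, two_mul]
  have e1 : algebraMap (ZMod p) F z * (y ^ p ^ (2 * l) + y) * x ^ p ^ l =
    algebraMap (ZMod p) F z * (y ^ p ^ (2 * l)) * x ^ p ^ l +
    algebraMap (ZMod p) F z * y * x ^ p ^ l := by ring
  rw [e1, map_add _ _ (algebraMap (ZMod p) F z * y * x ^ p ^ l), h, ← map_add, ← map_add, ← map_add]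
  congr 1
  rw [pow_succ, aux_add_pow]
  ring

theorem aux_trace_L (l : ℕ) (z : ZMod p) (y : F) :
    Algebra.trace (ZMod p) F (algebraMap (ZMod p) F z * (y ^ p ^ (2 * l) + y) * y ^ p ^ l) =
    2 * Algebra.trace (ZMod p) F (algebraMap (ZMod p) F z * y ^ (p ^ l + 1)) := by
  have h : Algebra.trace (ZMod p) F (algebraMap (ZMod p) F z * (y ^ p ^ (2 * l)) * y ^ p ^ l) =
      Algebra.trace (ZMod p) F (algebraMap (ZMod p) F z * y ^ p ^ l * y) := by
    rw [← aux_trace_pow l (algebraMap (ZMod p) F z * y ^ p ^ l * y), mul_pow, mul_pow, aux_alg_pow,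
      ← pow_mul, ← pow_add, two_mul]
  rw [mul_add, add_mul, map_add, h, two_mul]
  congr 2 <;> ring

theorem aux_two (hp : Odd p) : (2 : ZMod p) ≠ 0 := by
  haveI : Fact (2 < p) := ⟨by
    have := (Fact.out : p.Prime).two_le
    rcases hp with ⟨k, hk⟩; omega⟩
  exact Ring.two_ne_zero (by rw [ZMod.ringChar_zmod_n]; exact ((Fact.out : 2 < p)).ne')

/-- solvable case -/
theorem aux_W_solv (l : ℕ) (z : ZMod p) (β y : F)
    (hy : algebraMap (ZMod p) F z * (y ^ p ^ (2 * l) + y) = -β ^ p ^ l) :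
    auxW p F l (algebraMap (ZMod p) F z) β =
      ZMod.stdAddChar (-(z * Algebra.trace (ZMod p) F (y ^ (p ^ l + 1)))) *
        auxW p F l (algebraMap (ZMod p) F z) 0 := by
  unfold auxW
  rw [← Equiv.sum_comp (Equiv.addRight y), Finset.mul_sum]
  refine Finset.sum_congr rfl fun x _ => ?_
  rw [auxChi_apply, auxChi_apply, ← AddChar.map_add_eq_mul]
  congr 1
  rw [Equiv.coe_addRight, aux_shift, hy]
  have h1 : Algebra.trace (ZMod p) F (β * x) = Algebra.trace (ZMod p) F (β ^ p ^ l * x ^ p ^ l) := by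
    rw [← mul_pow, aux_trace_pow]
  have h2 : Algebra.trace (ZMod p) F (β * y) =
      -(2 * Algebra.trace (ZMod p) F (algebraMap (ZMod p) F z * y ^ (p ^ l + 1))) := by
    rw [← aux_trace_L, hy, neg_mul, map_neg, neg_neg, ← mul_pow, aux_trace_pow]
  have h3 : Algebra.trace (ZMod p) F (algebraMap (ZMod p) F z * y ^ (p ^ l + 1)) =
      z * Algebra.trace (ZMod p) F (y ^ (p ^ l + 1)) := by
    rw [← Algebra.smul_def, map_smul, smul_eq_mul]
  rw [map_add, map_add _ _ (β * y), h2, h1, h3, neg_mul, map_neg, zero_mul, add_zero]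
  ring

/-- orthogonality to kernel implies image -/
theorem aux_image (l : ℕ) (β : F)
    (h : ∀ v : F, v ^ p ^ (2 * l) + v = 0 → Algebra.trace (ZMod p) F (β * v) = 0) :
    ∃ d : F, d ^ p ^ (2 * l) + d = β := by
  let L : F →ₗ[ZMod p] F :=
    { toFun := fun x => x ^ p ^ (2 * l) + x
      map_add' := fun x y => by simp only [aux_add_pow]; ring
      map_smul' := fun c x => by
        simp only [Algebra.smul_def, mul_pow, aux_alg_pow, RingHom.id_apply]; ring }
  let φ : Module.Dual (ZMod p) F := Algebra.traceForm (ZMod p) F β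
  have hφ : φ ∈ (LinearMap.ker L).dualAnnihilator := by
    rw [Submodule.mem_dualAnnihilator]
    intro v hv
    exact h v hv
  rw [← LinearMap.range_dualMap_eq_dualAnnihilator_ker] at hφ
  obtain ⟨ψ, hψ⟩ := hφ
  have hnd : (Algebra.traceForm (ZMod p) F).Nondegenerate := traceForm_nondegenerate (ZMod p) F
  obtain ⟨c, hc⟩ := (LinearMap.BilinForm.toDual (Algebra.traceForm (ZMod p) F) hnd).surjective ψ
  obtain ⟨d, hd⟩ := (aux_pow_inj (p := p) (F := F) (2 * l)).2 c
  simp only at hd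
  refine ⟨d, ?_⟩
  have key : ∀ v, Algebra.trace (ZMod p) F (β * v) =
      Algebra.trace (ZMod p) F ((d ^ p ^ (2 * l) + d) * v) := by
    intro v
    have h1 := LinearMap.congr_fun hψ v
    rw [LinearMap.dualMap_apply, ← hc] at h1
    have h2 : Algebra.trace (ZMod p) F (c * (v ^ p ^ (2 * l) + v)) =
      Algebra.trace (ZMod p) F (β * v) := h1
    rw [← h2, mul_add, map_add, add_mul, map_add, ← hd, ← mul_pow, aux_trace_pow, add_comm]
  have : Algebra.traceForm (ZMod p) F (d ^ p ^ (2 * l) + d) = Algebra.traceForm (ZMod p) F β := by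
    ext v
    exact (key v).symm
  exact (LinearMap.BilinForm.toDual (Algebra.traceForm (ZMod p) F) hnd).injective this

/-- unsolvable case -/
theorem aux_W_unsolv (hp : Odd p) (l : ℕ) (z : ZMod p) (β : F)
    (hW : auxW p F l (algebraMap (ZMod p) F z) β ≠ 0) :
    ∃ d : F, d ^ p ^ (2 * l) + d = β := by
  apply aux_image
  intro v hv
  have h0 : 2 * Algebra.trace (ZMod p) F (algebraMap (ZMod p) F z * v ^ (p ^ l + 1)) = 0 := by
    rw [← aux_trace_L, hv]; simp
  have h1 := (mul_eq_zero.mp h0).resolve_left (aux_two hp)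
  have h2 : auxW p F l (algebraMap (ZMod p) F z) β =
      ZMod.stdAddChar (Algebra.trace (ZMod p) F (β * v)) *
      auxW p F l (algebraMap (ZMod p) F z) β := by
    conv_lhs => unfold auxW
    rw [← Equiv.sum_comp (Equiv.addRight v), auxW, Finset.mul_sum]
    refine Finset.sum_congr rfl fun x _ => ?_
    rw [auxChi_apply, auxChi_apply, ← AddChar.map_add_eq_mul]
    congr 1
    rw [Equiv.coe_addRight, aux_shift, hv, map_add _ _ (β * v), h1]
    simp [add_comm]
  have h3 : ZMod.stdAddChar (Algebra.trace (ZMod p) F (β * v)) = 1 := by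
    by_contra hne
    apply hne
    exact mul_right_cancel₀ hW (by rw [← h2, one_mul])
  apply ZMod.injective_stdAddChar
  rw [h3, AddChar.map_zero_eq_one]

open Classical in
/-- modulus -/
theorem aux_W_sq (hp : Odd p) (l : ℕ) :
    auxW p F l 1 0 * auxW p F l (-1) 0 =
      (Fintype.card F : ℂ) * ((Finset.univ.filter (fun v : F => v ^ p ^ (2 * l) + v = 0)).card : ℂ) := by
  have key : ∀ u : F, ∑ y : F, auxChi p F (1 * (y + u) ^ (p ^ l + 1)) * auxChi p F (-1 * y ^ (p ^ l + 1))
      = if u ^ p ^ (2 * l) + u = 0 then (Fintype.card F : ℂ) else 0 := by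
    intro u
    have e1 : ∀ y : F, auxChi p F (1 * (y + u) ^ (p ^ l + 1)) * auxChi p F (-1 * y ^ (p ^ l + 1)) =
        auxChi p F (u ^ (p ^ l + 1)) * auxChi p F ((u ^ p ^ (2 * l) + u) * y ^ p ^ l) := by
      intro y
      have := aux_shift (p := p) l 1 0 y u
      simp only [map_one, zero_mul, add_zero, one_mul] at this
      rw [auxChi_apply, auxChi_apply, auxChi_apply, auxChi_apply, ← AddChar.map_add_eq_mul,
        ← AddChar.map_add_eq_mul, one_mul, this, neg_one_mul, map_neg]
      congr 1; ring
    have e2 : ∑ y : F, auxChi p F ((u ^ p ^ (2 * l) + u) * y ^ p ^ l) =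
        ∑ y : F, auxChi p F ((u ^ p ^ (2 * l) + u) * y) :=
      Function.Bijective.sum_comp (aux_pow_inj (p := p) (F := F) l)
        (fun y => auxChi p F ((u ^ p ^ (2 * l) + u) * y))
    have e3 : ∑ y : F, auxChi p F ((u ^ p ^ (2 * l) + u) * y) =
        if u ^ p ^ (2 * l) + u = 0 then (Fintype.card F : ℂ) else 0 := by
      have := AddChar.sum_mulShift (ψ := auxChi p F) (u ^ p ^ (2 * l) + u) auxChi_prim
      rw [← Nat.cast_zero (R := ℂ), ← apply_ite Nat.cast]
      simpa only [mul_comm] using this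
    rw [Finset.sum_congr rfl (fun y _ => e1 y), ← Finset.mul_sum, e2, e3]
    split_ifs with hu
    · have h0 : 2 * Algebra.trace (ZMod p) F (algebraMap (ZMod p) F 1 * u ^ (p ^ l + 1)) = 0 := by
        rw [← aux_trace_L, hu]; simp
      have h1 := (mul_eq_zero.mp h0).resolve_left (aux_two hp)
      rw [map_one, one_mul] at h1
      rw [auxChi_apply, h1, AddChar.map_zero_eq_one, one_mul]
    · simp
  unfold auxW
  simp only [zero_mul, add_zero]
  rw [Finset.sum_mul_sum, Finset.sum_comm]
  have : ∀ y : F, ∑ x : F, auxChi p F (1 * x ^ (p ^ l + 1)) * auxChi p F (-1 * y ^ (p ^ l + 1)) =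
      ∑ u : F, auxChi p F (1 * (y + u) ^ (p ^ l + 1)) * auxChi p F (-1 * y ^ (p ^ l + 1)) := by
    intro y
    rw [← Equiv.sum_comp (Equiv.addLeft y)]
    rfl
  rw [Finset.sum_congr rfl (fun y _ => this y), Finset.sum_comm,
    Finset.sum_congr rfl (fun u _ => key u), ← Finset.sum_filter, Finset.sum_const, nsmul_eq_mul,
    mul_comm]

theorem aux_root {G : Type} [CommGroup G] [Finite G] [IsCyclic G] (n d : ℕ) (hd : 0 < d)
    (h : n * d ∣ Nat.card G) (z : G) (hz : z ^ d = 1) : ∃ w : G, w ^ n = z := by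
  obtain ⟨g, hg⟩ := IsCyclic.exists_monoid_generator (α := G)
  obtain ⟨j, hj⟩ := Submonoid.mem_powers_iff _ _ |>.mp (hg z)
  have ho : orderOf g = Nat.card G := by
    apply orderOf_eq_card_of_forall_mem_zpowers
    intro x
    obtain ⟨i, hi⟩ := Submonoid.mem_powers_iff _ _ |>.mp (hg x)
    exact ⟨i, by simpa using hi⟩
  have h1 : orderOf g ∣ j * d := by
    apply orderOf_dvd_of_pow_eq_one
    rw [pow_mul, hj, hz]
  rw [ho] at h1
  obtain ⟨i, hi⟩ := Nat.dvd_of_mul_dvd_mul_right hd (h.trans h1)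
  exact ⟨g ^ i, by rw [← pow_mul, mul_comm, ← hi, hj]⟩

theorem aux_ker {G : Type} [CommGroup G] [Finite G] [IsCyclic G] (d : ℕ)
    (h : d ∣ Nat.card G) : Nat.card (powMonoidHom d : G →* G).ker = d := by
  rw [IsCyclic.card_powMonoidHom_ker, Nat.gcd_eq_right h]

theorem aux_stable {G : Type} [CommGroup G] [Finite G] (C : Subgroup G) (A : Set G)
    (hA : ∀ a ∈ A, ∀ c ∈ C, a * c ∈ A) : Nat.card C ∣ Nat.card A := by
  have h : A = QuotientGroup.mk ⁻¹' ((QuotientGroup.mk : G → G ⧸ C) '' A) := by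
    ext x
    constructor
    · intro hx; exact ⟨x, hx, rfl⟩
    · rintro ⟨a, ha, hax⟩
      have := hA a ha _ (QuotientGroup.eq.mp hax)
      simpa using this
  rw [h, Nat.card_congr (QuotientGroup.preimageMkEquivSubgroupProdSet C _), Nat.card_prod]
  exact Dvd.intro _ rfl

open Classical in
theorem aux_units_card (P : F → Prop) [DecidablePred P] (h0 : P 0) :
    (Finset.univ.filter P).card = 1 + Nat.card {u : Fˣ | P u} := by
  have h : Finset.univ.filter P =
      insert 0 ((Finset.univ.filter (fun u : Fˣ => P u)).image Units.val) := by
    ext x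
    simp only [Finset.mem_filter, Finset.mem_univ, true_and, Finset.mem_insert, Finset.mem_image]
    constructor
    · intro hx
      by_cases h : x = 0
      · exact Or.inl h
      · exact Or.inr ⟨Units.mk0 x h, hx, rfl⟩
    · rintro (rfl | ⟨u, hu, rfl⟩)
      · exact h0
      · exact hu
  rw [h, Finset.card_insert_of_notMem, Finset.card_image_of_injective _ Units.val_injective, add_comm]
  · congr 1
    rw [Nat.card_eq_fintype_card]
    exact (Fintype.card_subtype _).symm
  · simp

theorem aux_card_units {e : ℕ} (hc : Fintype.card F = p ^ e) : Nat.card Fˣ = p ^ e - 1 := by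
  rw [Nat.card_units, Nat.card_eq_fintype_card, hc]

theorem aux_dvd_pow (a n k : ℕ) : a ^ n - 1 ∣ a ^ (n * k) - 1 := by
  have := Nat.sub_dvd_pow_sub_pow (a ^ n) 1 k
  rwa [one_pow, ← pow_mul] at this

open Classical in
theorem aux_fix_card {e r t : ℕ} (he : e = r * t) (hr : 0 < r) (hc : Fintype.card F = p ^ e) :
    (Finset.univ.filter (fun x : F => x ^ p ^ r = x)).card = p ^ r := by
  have hp1 : 1 < p ^ r := Nat.one_lt_pow hr.ne' (Fact.out : p.Prime).one_lt
  rw [aux_units_card]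
  · have h1 := aux_ker (G := Fˣ) (p ^ r - 1) (by
      rw [aux_card_units hc, he]; exact aux_dvd_pow p r t)
    have h2 : {u : Fˣ | (u : F) ^ p ^ r = u} = ((powMonoidHom (p ^ r - 1) : Fˣ →* Fˣ).ker : Set Fˣ) := by
      ext u
      simp only [Set.mem_ofPred_eq, SetLike.mem_coe, MonoidHom.mem_ker, powMonoidHom_apply]
      rw [← Units.val_pow_eq_pow_val, Units.val_inj]
      conv_lhs => rw [← Nat.sub_add_cancel hp1.le, pow_succ]
      exact mul_eq_right
    rw [h2]
    rw [SetLike.coe_sort_coe, h1]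
    omega
  · rw [zero_pow]; omega

theorem aux_gcd {e n r : ℕ} (hc : Fintype.card F = p ^ e) (hr : Nat.gcd n e = r) (x : F) :
    x ^ p ^ n = x ↔ x ^ p ^ r = x := by
  have key : ∀ j, Function.IsPeriodicPt (fun y : F => y ^ p) j x ↔ x ^ p ^ j = x := by
    intro j
    rw [Function.IsPeriodicPt, Function.IsFixedPt, pow_iterate]
  rw [← key, ← key]
  constructor
  · intro h
    rw [← hr]
    exact h.gcd ((key e).mpr (by rw [← hc, FiniteField.pow_card]))
  · intro h
    exact h.trans_dvd (hr ▸ Nat.gcd_dvd_left n e)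

theorem aux_neg_iter (r k : ℕ) (hp : Odd p) (w : F) (hw : w ^ p ^ r = -w) :
    w ^ p ^ (r * (2 * k + 1)) = -w := by
  have h2 : w ^ p ^ (r * 2) = w := by
    rw [mul_two, pow_add, pow_mul, hw, Odd.neg_pow hp.pow, hw, neg_neg]
  have h3 : ∀ k : ℕ, w ^ p ^ (r * 2 * k) = w := by
    intro k
    induction k with
    | zero => simp
    | succ k ih => rw [mul_add, mul_one, pow_add, pow_mul, ih, h2]
  rw [mul_add, mul_one, ← mul_assoc, pow_add, pow_mul, h3, hw]

open Classical in
theorem aux_V_card {e l s k t : ℕ} (hp : Odd p) (hs : 0 < s) (hl : l = s * (2 * k + 1))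
    (he : e = 4 * s * t) (hg : Nat.gcd (2 * l) e = 2 * s) (hc : Fintype.card F = p ^ e) :
    (Finset.univ.filter (fun v : F => v ^ p ^ (2 * l) + v = 0)).card = p ^ (2 * s) := by
  have hp1 : 1 < p ^ (2 * s) := Nat.one_lt_pow (by omega) (Fact.out : p.Prime).one_lt
  obtain ⟨w, hw⟩ := aux_root (G := Fˣ) (p ^ (2 * s) - 1) 2 two_pos (by
    rw [aux_card_units hc, he]
    refine Dvd.dvd.trans ?_ (aux_dvd_pow p (4 * s) t)
    have : p ^ (4 * s) - 1 = (p ^ (2 * s) - 1) * (p ^ (2 * s) + 1) := by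
      rw [mul_comm (p ^ (2 * s) - 1), ← Nat.sq_sub_sq, ← pow_mul, one_pow]; congr 2; ring
    rw [this]
    apply Nat.mul_dvd_mul_left
    have : Odd (p ^ (2 * s)) := hp.pow
    exact (this.add_odd odd_one).two_dvd) (-1) (by simp)
  have hw0 : (w : F) ≠ 0 := w.ne_zero
  have hw1 : (w : F) ^ p ^ (2 * s) = -w := by
    rw [← Nat.sub_add_cancel hp1.le, pow_succ, ← Units.val_pow_eq_pow_val, hw]; simp
  have hw2 : (w : F) ^ p ^ (2 * l) = -w := by
    rw [hl, ← mul_assoc]; exact aux_neg_iter _ _ hp _ hw1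
  rw [← aux_fix_card (F := F) (p := p) (e := e) (r := 2 * s) (t := 2 * t) (by rw [he]; ring) (by omega) hc]
  symm
  rw [← Finset.card_image_of_injective _ (mul_right_injective₀ hw0)]
  congr 1
  ext v
  simp only [Finset.mem_image, Finset.mem_filter, Finset.mem_univ, true_and]
  constructor
  · rintro ⟨x, hx, rfl⟩
    rw [← aux_gcd hc hg] at hx
    rw [mul_pow, hx, hw2]; ring
  · intro hv
    refine ⟨(w : F)⁻¹ * v, ?_, by field_simp⟩
    rw [← aux_gcd hc hg, mul_pow, inv_pow, hw2, eq_neg_of_add_eq_zero_left hv]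
    field_simp

theorem aux_N_dvd {s : ℕ} (e t : ℕ) (he : e = 4 * s * t) :
    (p ^ s + 1) * (p - 1) ∣ p ^ e - 1 := by
  have h1 : p ^ (2 * s) - 1 ∣ p ^ e - 1 := by
    have := aux_dvd_pow p (2 * s) (2 * t)
    rwa [show 2 * s * (2 * t) = e by rw [he]; ring] at this
  refine Dvd.dvd.trans ?_ h1
  have : p ^ (2 * s) - 1 = (p ^ s + 1) * (p ^ s - 1) := by
    rw [← Nat.sq_sub_sq, ← pow_mul, one_pow, mul_comm 2 s]
  rw [this]
  apply Nat.mul_dvd_mul_left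
  have := aux_dvd_pow p 1 s
  rwa [pow_one, one_mul] at this

theorem aux_N_dvd2 {l s k : ℕ} (hl : l = s * (2 * k + 1)) : p ^ s + 1 ∣ p ^ l + 1 := by
  have := Odd.nat_add_dvd_pow_add_pow (p ^ s) 1 (n := 2 * k + 1) ⟨k, rfl⟩
  rwa [one_pow, ← pow_mul, ← hl] at this

theorem aux_W_const {e l s k t : ℕ} (hl : l = s * (2 * k + 1))
    (he : e = 4 * s * t) (hc : Fintype.card F = p ^ e) (z : ZMod p) (hz : z ≠ 0) :
    auxW p F l (algebraMap (ZMod p) F z) 0 = auxW p F l 1 0 := by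
  have hp1 : 1 < p := (Fact.out : p.Prime).one_lt
  have hz' : algebraMap (ZMod p) F z ≠ 0 := by simpa using hz
  obtain ⟨w, hw⟩ := aux_root (G := Fˣ) (p ^ s + 1) (p - 1) (by omega) (by
    rw [aux_card_units hc]; exact aux_N_dvd e t he) (Units.mk0 _ hz') (by
      ext
      simp only [Units.val_pow_eq_pow_val, Units.val_mk0, Units.val_one]
      rw [← map_pow, ZMod.pow_card_sub_one_eq_one hz, map_one])
  have hw1 : (w : F) ^ (p ^ s + 1) = algebraMap (ZMod p) F z := by
    rw [← Units.val_pow_eq_pow_val, hw]; rfl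
  have hw0 : (w : F) ≠ 0 := w.ne_zero
  have hw2 : (w : F) ^ p ^ (s * 2) = w := by
    have h := aux_alg_pow (F := F) s z
    rw [← hw1, ← pow_mul, add_mul, one_mul, ← pow_add, ← mul_two, pow_add, pow_succ, mul_comm] at h
    exact mul_left_cancel₀ (pow_ne_zero _ hw0) h
  have h3 : ∀ k : ℕ, (w : F) ^ p ^ (s * 2 * k) = w := by
    intro k
    induction k with
    | zero => simp
    | succ k ih => rw [mul_add, mul_one, pow_add, pow_mul, ih, hw2]
  have hw3 : (w : F) ^ (p ^ l + 1) = algebraMap (ZMod p) F z := by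
    rw [← hw1, pow_succ, pow_succ, hl, mul_add, mul_one, ← mul_assoc, pow_add, pow_mul, h3]
  unfold auxW
  rw [← Equiv.sum_comp (Equiv.mulLeft₀ (w : F) hw0) (fun x => auxChi p F (1 * x ^ (p ^ l + 1) + 0 * x))]
  refine Finset.sum_congr rfl fun x _ => ?_
  simp only [Equiv.mulLeft₀_apply, mul_pow, hw3, zero_mul, one_mul, add_zero]

open Classical in
theorem aux_sum_char (c : ZMod p) :
    ∑ z : ZMod p, (ZMod.stdAddChar (z * c) : ℂ) = if c = 0 then (p : ℂ) else 0 := by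
  have := AddChar.sum_mulShift (ψ := ZMod.stdAddChar (N := p)) c (ZMod.isPrimitive_stdAddChar p)
  rw [this, ZMod.card]
  split_ifs <;> simp

theorem aux_alg_trace (l : ℕ) (z : ZMod p) (x : F) :
    auxChi p F (algebraMap (ZMod p) F z * x ^ (p ^ l + 1) + 0 * x) =
      ZMod.stdAddChar (z * Algebra.trace (ZMod p) F (x ^ (p ^ l + 1))) := by
  rw [auxChi_apply, zero_mul, add_zero, ← Algebra.smul_def, map_smul, smul_eq_mul]

theorem aux_int {e l s k t : ℕ} (hl : l = s * (2 * k + 1))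
    (he : e = 4 * s * t) (hc : Fintype.card F = p ^ e) :
    ∃ j : ℕ, ((p : ℂ) - 1) * auxW p F l 1 0 =
      p * (1 + ((p ^ s + 1) * (p - 1) * j)) - (p : ℂ) ^ e := by
  classical
  have hp1 : 1 < p := (Fact.out : p.Prime).one_lt
  have h1 : ∑ z : ZMod p, auxW p F l (algebraMap (ZMod p) F z) 0 = p *
      ((Finset.univ.filter (fun x : F => Algebra.trace (ZMod p) F (x ^ (p ^ l + 1)) = 0)).card : ℂ) := by
    unfold auxW
    rw [Finset.sum_comm]
    simp only [aux_alg_trace, aux_sum_char]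
    rw [← Finset.sum_filter, Finset.sum_const, nsmul_eq_mul, mul_comm]
  have h2 : ∑ z : ZMod p, auxW p F l (algebraMap (ZMod p) F z) 0 =
      (p : ℂ) ^ e + ((p : ℂ) - 1) * auxW p F l 1 0 := by
    rw [← Finset.add_sum_erase _ _ (Finset.mem_univ (0 : ZMod p))]
    congr 1
    · simp [auxW, AddChar.map_zero_eq_one, hc]
    · rw [Finset.sum_congr rfl (fun z hz => aux_W_const hl he hc z (Finset.ne_of_mem_erase hz)),
        Finset.sum_const, Finset.card_erase_of_mem (Finset.mem_univ _), Finset.card_univ, ZMod.card,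
        nsmul_eq_mul, Nat.cast_sub hp1.le, Nat.cast_one]
  rw [h1] at h2
  rw [aux_units_card _ (by rw [zero_pow (by omega), map_zero])] at h2
  have h3 : (p ^ s + 1) * (p - 1) ∣
      Nat.card {u : Fˣ | Algebra.trace (ZMod p) F ((u : F) ^ (p ^ l + 1)) = 0} := by
    have hk := aux_ker (G := Fˣ) ((p ^ s + 1) * (p - 1)) (by
      rw [aux_card_units hc]; exact aux_N_dvd e t he)
    nth_rw 1 [← hk]
    apply aux_stable
    intro a ha c hcc
    simp only [Set.mem_ofPred_eq] at ha ⊢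
    rw [MonoidHom.mem_ker, powMonoidHom_apply] at hcc
    have hc1 : ((c : F) ^ (p ^ l + 1)) ^ (p - 1) = 1 := by
      obtain ⟨i, hi⟩ := aux_N_dvd2 (p := p) hl
      rw [hi, ← pow_mul, show (p ^ s + 1) * i * (p - 1) = (p ^ s + 1) * (p - 1) * i by ring, pow_mul,
        ← Units.val_pow_eq_pow_val, hcc]
      simp
    have hc2 : ∃ z : ZMod p, algebraMap (ZMod p) F z = (c : F) ^ (p ^ l + 1) := by
      have hpp : ((c : F) ^ (p ^ l + 1)) ^ p = (c : F) ^ (p ^ l + 1) := by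
        have h := pow_succ ((c : F) ^ (p ^ l + 1)) (p - 1)
        rwa [Nat.sub_add_cancel hp1.le, hc1, one_mul] at h
      haveI : CharP F p := aux_charP
      have h := (Subfield.mem_bot_iff_pow_eq_self (p := p) (F := F)).mpr hpp
      exact (bot_le : ⊥ ≤ (algebraMap (ZMod p) F).fieldRange) h
    obtain ⟨z, hz⟩ := hc2
    rw [Units.val_mul, mul_pow, mul_comm, ← hz, ← Algebra.smul_def, map_smul, ha, smul_zero]
  obtain ⟨j, hj⟩ := h3
  refine ⟨j, ?_⟩
  rw [hj] at h2
  push_cast [Nat.cast_sub hp1.le] at h2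
  rw [h2]; ring

theorem aux_W_value {e l s k t m : ℕ} (hp : Odd p) (hs : 0 < s) (hl : l = s * (2 * k + 1))
    (he : e = 4 * s * t) (hm : e = 2 * m) (hg : Nat.gcd (2 * l) e = 2 * s)
    (hc : Fintype.card F = p ^ e) :
    auxW p F l 1 0 = -(p : ℂ) ^ (m + s) := by
  have hp1 : 1 < p := (Fact.out : p.Prime).one_lt
  have hp3 : 3 ≤ p := by rcases hp with ⟨k, hk⟩; omega
  have h1 := aux_W_sq (p := p) (F := F) hp l
  rw [aux_V_card hp hs hl he hg hc, hc] at h1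
  have h2 := aux_W_const (p := p) (F := F) hl he hc (-1) (by simp)
  rw [map_neg, map_one] at h2
  rw [h2] at h1
  have h3 : auxW p F l 1 0 ^ 2 = ((p : ℂ) ^ (m + s)) ^ 2 := by
    rw [sq, h1, hm]; push_cast; ring
  rcases sq_eq_sq_iff_eq_or_eq_neg.mp h3 with h | h
  · exfalso
    obtain ⟨j, hj⟩ := aux_int (p := p) (F := F) hl he hc
    rw [h] at hj
    obtain ⟨r, hr⟩ := aux_N_dvd (p := p) e t he
    have hr' : p ^ e = 1 + (p ^ s + 1) * (p - 1) * r := by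
      have : 0 < p ^ e := by positivity
      omega
    have hr2 : (p : ℤ) ^ e = 1 + (p ^ s + 1) * (p - 1) * r := by
      have := congrArg (Nat.cast : ℕ → ℤ) hr'
      push_cast [Nat.cast_sub hp1.le] at this
      exact this
    have hj2 : ((p : ℤ) - 1) * p ^ (m + s) = p * (1 + ((p ^ s + 1) * (p - 1) * j)) - (p : ℤ) ^ e := by
      exact_mod_cast hj
    rw [hr2] at hj2
    have hpz : ((p : ℤ) - 1) ≠ 0 := by omega
    have hj3 : (p : ℤ) ^ (m + s) = 1 + (p ^ s + 1) * (p * j - r) := by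
      apply mul_left_cancel₀ hpz
      rw [hj2]; ring
    have hd : ((p : ℤ) ^ s + 1) ∣ p ^ (m + s) + 1 := by
      have := Odd.nat_add_dvd_pow_add_pow (p ^ s) 1 (n := 2 * t + 1) ⟨t, rfl⟩
      rw [one_pow, ← pow_mul, show s * (2 * t + 1) = m + s by
        have : m = 2 * s * t := by
          have : 2 * m = 2 * (2 * s * t) := by rw [← hm, he]; ring
          omega
        rw [this]; ring] at this
      exact_mod_cast this
    rw [hj3] at hd
    have hd2 : ((p : ℤ) ^ s + 1) ∣ 2 := by
      have := dvd_sub hd (Dvd.intro (p * j - r : ℤ) rfl)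
      ring_nf at this ⊢
      exact this
    have hle := Int.le_of_dvd (by norm_num) hd2
    have : (p : ℤ) ≤ p ^ s := by exact_mod_cast Nat.le_self_pow hs.ne' p
    omega
  · exact h

theorem aux_eta (x : ZMod p) : eta p x = quadraticChar (ZMod p) x := by
  classical
  rw [quadraticChar_apply, quadraticCharFun, eta]
  congr

theorem aux_count (hp : Odd p) (t : ZMod p) (ht : t ≠ 0) :
    ((Finset.filter (fun w : ZMod p => 1 + w ^ 2 * t = 0) ({0}ᶜ : Finset (ZMod p))).card : ℤ) =
      eta p (-t) + 1 := by
  classical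
  have hF : ringChar (ZMod p) ≠ 2 := by
    rw [ZMod.ringChar_zmod_n]
    rintro rfl
    exact absurd hp (by decide)
  have h1 := quadraticChar_card_sqrts hF (-t⁻¹)
  have h2 : quadraticChar (ZMod p) (-t⁻¹) = eta p (-t) := by
    rw [aux_eta, show -t⁻¹ = (-t) * (t⁻¹) ^ 2 by field_simp, map_mul,
      quadraticChar_sq_one' (inv_ne_zero ht), mul_one]
  rw [← h2, ← h1]
  congr 2
  ext w
  simp only [Finset.mem_filter, Finset.mem_compl, Finset.mem_singleton, Set.mem_toFinset,
    Set.mem_ofPred_eq]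
  constructor
  · rintro ⟨_, h⟩
    field_simp
    linear_combination h
  · intro h
    refine ⟨?_, ?_⟩
    · rintro rfl
      rw [zero_pow two_ne_zero] at h
      exact inv_ne_zero ht (neg_eq_zero.mp h.symm)
    · rw [h]; field_simp; ring

theorem aux_sum_ne (c : ZMod p) :
    ∑ z ∈ ({0}ᶜ : Finset (ZMod p)), (ZMod.stdAddChar (-(z * c)) : ℂ) =
      (if c = 0 then (p : ℂ) else 0) - 1 := by
  have h := aux_sum_char (p := p) (-c)
  rw [← Finset.sum_add_sum_compl {0}, Finset.sum_singleton, zero_mul, AddChar.map_zero_eq_one] at h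
  simp only [neg_eq_zero, mul_neg] at h
  rw [← h]; ring

theorem aux_double (t : ZMod p) :
    ∑ z1 ∈ ({0}ᶜ : Finset (ZMod p)), (ZMod.stdAddChar (-z1) : ℂ) *
      ∑ z3 ∈ ({0}ᶜ : Finset (ZMod p)), ZMod.stdAddChar (-(z1 * ((z3 / z1) ^ 2 * t))) =
    p * ((Finset.filter (fun w : ZMod p => 1 + w ^ 2 * t = 0) ({0}ᶜ : Finset (ZMod p))).card : ℂ)
      - (p - 1) := by
  have hp1 : 1 < p := (Fact.out : p.Prime).one_lt
  have h1 : ∀ z1 ∈ ({0}ᶜ : Finset (ZMod p)), (ZMod.stdAddChar (-z1) : ℂ) *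
      ∑ z3 ∈ ({0}ᶜ : Finset (ZMod p)), ZMod.stdAddChar (-(z1 * ((z3 / z1) ^ 2 * t))) =
      ∑ w ∈ ({0}ᶜ : Finset (ZMod p)), ZMod.stdAddChar (-(z1 * (1 + w ^ 2 * t))) := by
    intro z1 hz1
    have hz : z1 ≠ 0 := by simpa using hz1
    rw [Finset.mul_sum]
    refine Finset.sum_bij' (fun z _ => z / z1) (fun w _ => w * z1) ?_ ?_ ?_ ?_ ?_
    · intro z h; simp at h ⊢; exact ⟨h, hz⟩
    · intro z h; simp at h ⊢; exact ⟨h, hz⟩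
    · intro z h; field_simp
    · intro z h; field_simp
    · intro z h
      rw [← AddChar.map_add_eq_mul]; congr 1; ring
  rw [Finset.sum_congr rfl h1, Finset.sum_comm]
  simp only [aux_sum_ne]
  rw [Finset.sum_sub_distrib, ← Finset.sum_filter, Finset.sum_const, Finset.sum_const,
    Finset.card_compl, Finset.card_singleton, ZMod.card, nsmul_eq_mul, nsmul_eq_mul,
    Nat.cast_sub hp1.le, Nat.cast_one]
  ring

theorem aux_zeta (x : ZMod p) : zetaP p ^ x.val = ZMod.stdAddChar x := by
  have h := ZMod.stdAddChar_coe (N := p) (x.val : ℤ)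
  rw [Int.cast_natCast, ZMod.natCast_val, ZMod.cast_id] at h
  rw [h, zetaP, ← Complex.exp_nat_mul]
  congr 1
  push_cast; ring

end helpers

theorem aux_psi (p e l : ℕ) [Fact p.Prime] (a : GaloisField p e) :
    letI : Fintype (GaloisField p e) := Fintype.ofFinite _
    psi3 p e l a = ((p : ℂ) - 1) / 2 * (p : ℂ) ^ ((e : ℤ) - 3) *
    ∑ z1 ∈ ({0}ᶜ : Finset (ZMod p)), ZMod.stdAddChar (-z1) *
      ∑ z3 ∈ ({0}ᶜ : Finset (ZMod p)),
        auxW p (GaloisField p e) l (algebraMap (ZMod p) (GaloisField p e) z1)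
          (a * algebraMap (ZMod p) (GaloisField p e) z3) := by
  simp only [psi3, weilSum, aux_zeta]
  rfl

theorem aux_arith {l e m s : ℕ} (hl : 0 < l) (he : e = 2 * m) (hs : s = Nat.gcd l e)
    (hsm : s ∣ m) (heven : Even (m / s)) :
    0 < s ∧ (∃ k, l = s * (2 * k + 1)) ∧ (∃ t, e = 4 * s * t) ∧ Nat.gcd (2 * l) e = 2 * s := by
  have hs0 : 0 < s := hs ▸ Nat.gcd_pos_of_pos_left _ hl
  obtain ⟨r, hr⟩ := heven
  have hm : m = s * (r + r) := by rw [← hr, Nat.mul_div_cancel' hsm]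
  obtain ⟨j, hj⟩ : s ∣ l := hs ▸ Nat.gcd_dvd_left l e
  have he' : e = s * (4 * r) := by rw [he, hm]; ring
  have hcop : Nat.gcd j (4 * r) = 1 := by
    have : s * Nat.gcd j (4 * r) = s * 1 := by
      rw [← Nat.gcd_mul_left, ← hj, ← he', ← hs, mul_one]
    exact Nat.eq_of_mul_eq_mul_left hs0 this
  have hodd : Odd j := by
    rw [← Nat.not_even_iff_odd]
    intro h
    have : 2 ∣ Nat.gcd j (4 * r) := Nat.dvd_gcd h.two_dvd ⟨2 * r, by ring⟩
    rw [hcop] at this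
    omega
  refine ⟨hs0, ?_, ⟨r, by rw [he']; ring⟩, ?_⟩
  · obtain ⟨k, hk⟩ := hodd
    exact ⟨k, by rw [hj, hk]⟩
  · have h1 : Nat.gcd j (2 * r) = 1 :=
      Nat.Coprime.coprime_dvd_right ⟨2, by ring⟩ hcop
    rw [hj, he', show 2 * (s * j) = 2 * s * j by ring, show s * (4 * r) = 2 * s * (2 * r) by ring,
      Nat.gcd_mul_left, h1, mul_one]

/-- the value of `ψ_3(a)` for `a ≠ 0` when `m/s` is even (paper Lemma 11). -/
theorem psi3_eval_even (p e l m s : ℕ) [Fact p.Prime] (hp : Odd p)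
    (hl : 0 < l) (hm : 1 ≤ m) (he : e = 2 * m) (hs : s = Nat.gcd l e)
    (hsm : s ∣ m) (heven : Even (m / s)) (a : GaloisField p e) (ha : a ≠ 0) :
    ((¬ ∃ x : GaloisField p e, x ^ p ^ (2 * l) + x = -a ^ p ^ l) →
      psi3 p e l a = 0) ∧
    ∀ γ : GaloisField p e, γ ^ p ^ (2 * l) + γ = -a ^ p ^ l →
      (tr p e (γ ^ (p ^ l + 1)) ≠ 0 →
        psi3 p e l a =
          -(((p : ℂ) - 1) / 2) * (p : ℂ) ^ ((e : ℤ) + m + s - 3) -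
            ((p : ℂ) - 1) / 2 * (p : ℂ) ^ ((e : ℤ) + m + s - 2) *
              ((eta p (-(tr p e (γ ^ (p ^ l + 1)))) : ℤ) : ℂ)) ∧
      (tr p e (γ ^ (p ^ l + 1)) = 0 →
        psi3 p e l a = ((p : ℂ) - 1) ^ 2 / 2 * (p : ℂ) ^ ((e : ℤ) + m + s - 3)) := by
  letI : Fintype (GaloisField p e) := Fintype.ofFinite _
  obtain ⟨hs0, ⟨k, hk⟩, ⟨t, ht⟩, hg⟩ := aux_arith hl he hs hsm heven
  have he0 : e ≠ 0 := by omega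
  have hp1 : 1 < p := (Fact.out : p.Prime).one_lt
  have hp0 : (p : ℂ) ≠ 0 := by exact_mod_cast (by omega : p ≠ 0)
  have hc : Fintype.card (GaloisField p e) = p ^ e := by
    rw [← Nat.card_eq_fintype_card, GaloisField.card p e he0]
  have hpsi := aux_psi p e l a
  constructor
  · intro hno
    rw [hpsi]
    rw [Finset.sum_eq_zero, mul_zero]
    intro z1 hz1
    rw [Finset.sum_eq_zero, mul_zero]
    intro z3 hz3
    have hz3' : z3 ≠ 0 := by simpa using hz3
    by_contra hne
    obtain ⟨d, hd⟩ := aux_W_unsolv hp l z1 _ hne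
    apply hno
    refine ⟨(-(algebraMap (ZMod p) (GaloisField p e) z3⁻¹ * d)) ^ p ^ l, ?_⟩
    have hodd : ∀ n, Odd (p ^ n) := fun n => hp.pow
    rw [← pow_mul, mul_comm (p ^ l), pow_mul, ← aux_add_pow, (hodd _).neg_pow, mul_pow, aux_alg_pow,
      ← neg_add, ← mul_add, hd, (hodd _).neg_pow, map_inv₀]
    have : algebraMap (ZMod p) (GaloisField p e) z3 ≠ 0 := by simpa using hz3'
    congr 2
    field_simp
  · intro γ hγ
    set T := tr p e (γ ^ (p ^ l + 1)) with hT
    have hW : ∀ z1 ∈ ({0}ᶜ : Finset (ZMod p)), (ZMod.stdAddChar (-z1) : ℂ) *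
      ∑ z3 ∈ ({0}ᶜ : Finset (ZMod p)),
        auxW p (GaloisField p e) l (algebraMap (ZMod p) (GaloisField p e) z1)
          (a * algebraMap (ZMod p) (GaloisField p e) z3) =
        -(p : ℂ) ^ (m + s) * (ZMod.stdAddChar (-z1) *
          ∑ z3 ∈ ({0}ᶜ : Finset (ZMod p)), ZMod.stdAddChar (-(z1 * ((z3 / z1) ^ 2 * T)))) := by
      intro z1 hz1
      have hz : z1 ≠ 0 := by simpa using hz1
      have hz' : algebraMap (ZMod p) (GaloisField p e) z1 ≠ 0 := by simpa using hz
      rw [mul_left_comm]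
      congr 1
      rw [Finset.mul_sum]
      refine Finset.sum_congr rfl fun z3 _ => ?_
      rw [aux_W_solv l z1 _ (algebraMap (ZMod p) (GaloisField p e) (z3 / z1) * γ),
        aux_W_const hk ht hc z1 hz, aux_W_value hp hs0 hk ht he hg hc, mul_comm]
      · congr 5
        rw [mul_pow, pow_succ, aux_alg_pow, ← map_mul, ← Algebra.smul_def, map_smul, smul_eq_mul, sq]
        rfl
      · rw [mul_pow, aux_alg_pow, ← mul_add, hγ, mul_pow, aux_alg_pow, map_div₀]
        field_simp
    rw [Finset.sum_congr rfl hW, ← Finset.mul_sum, aux_double] at hpsi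
    have hpow : (p : ℂ) ^ ((e : ℤ) - 3) * (p : ℂ) ^ (m + s) = (p : ℂ) ^ ((e : ℤ) + m + s - 3) := by
      rw [← zpow_natCast, ← zpow_add₀ hp0]; congr 1; push_cast; ring
    have hpow2 : (p : ℂ) ^ ((e : ℤ) + m + s - 2) = (p : ℂ) ^ ((e : ℤ) + m + s - 3) * p := by
      rw [← zpow_add_one₀ hp0]; congr 1; ring
    constructor
    · intro hT0
      have hcount := congrArg (Int.cast : ℤ → ℂ) (aux_count hp T hT0)
      rw [Int.cast_natCast] at hcount
      push_cast at hcount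
      rw [hpsi, hcount, hpow2, ← hpow]
      ring
    · intro hT0
      rw [hpsi, hT0, ← hpow]
      simp only [mul_zero, add_zero, one_ne_zero, Finset.filter_false, Finset.card_empty,
        Nat.cast_zero]
      ring

end
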